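/- arXiv:1005.1424 — 2 statements merged into one kernel-verified Lean document; each statement's English description precedes it below -/
import Mathlib

section
/- Let A, B : Matrix n n ℝ≥0 (n finite nonempty) be irreducible matrices that commute under the max-product, let α be an eigenvalue of A (A ⊗ v = α • v for some v ≠ 0) and β an eigenvalue of B. Then A and B have a common eigennode: there exist a node i : n and cycles l₁, l₂ through i (nonempty lists of nodes with head i) such that the weight of l₁ in A attains α, i.e. weight A l₁ = α ^ (l₁.length), and the weight of l₂ in B attains β, i.e. weight B l₂ = β ^ (l₂.length). -/
open scoped NNReal

/-- Max-algebraic product of matrices over ℝ≥0. -/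
noncomputable def maxMul {l m p : Type*} [Fintype m]
    (A : Matrix l m ℝ≥0) (B : Matrix m p ℝ≥0) : Matrix l p ℝ≥0 :=
  fun i k => ⨆ j, A i j * B j k

/-- Max-algebraic action of a matrix on a vector over ℝ≥0. -/
noncomputable def maxVec {l m : Type*} [Fintype m]
    (A : Matrix l m ℝ≥0) (v : m → ℝ≥0) : l → ℝ≥0 :=
  fun i => ⨆ j, A i j * v j

/-- A matrix over ℝ≥0 is irreducible if its positivity digraph is strongly connected. -/
def MaxIrreducible {n : Type*} (A : Matrix n n ℝ≥0) : Prop :=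
  ∀ i j : n, i ≠ j → Relation.TransGen (fun a b => 0 < A a b) i j

/-- The product of the entries of `A` along a cycle given by a list of nodes
(consecutive edges together with the wrap-around edge from the last node to the head). -/
noncomputable def cycleWeight {n : Type*} (A : Matrix n n ℝ≥0) (l : List n) : ℝ≥0 :=
  ((l.zip (l.rotate 1)).map fun p => A p.1 p.2).prod

theorem maxVec_le_iff {l m : Type*} [Fintype m] {A : Matrix l m ℝ≥0} {v : m → ℝ≥0} {i : l}
    {c : ℝ≥0} : maxVec A v i ≤ c ↔ ∀ j, A i j * v j ≤ c :=
  ciSup_le_iff' (Set.finite_range _).bddAbove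

theorem mul_le_maxVec {l m : Type*} [Fintype m] (A : Matrix l m ℝ≥0) (v : m → ℝ≥0) (i : l)
    (j : m) : A i j * v j ≤ maxVec A v i :=
  maxVec_le_iff.1 le_rfl j

theorem exists_mul_eq_maxVec {l m : Type*} [Fintype m] [Nonempty m] (A : Matrix l m ℝ≥0)
    (v : m → ℝ≥0) (i : l) : ∃ j, A i j * v j = maxVec A v i :=
  exists_eq_ciSup_of_finite

theorem maxVec_mono {l m : Type*} [Fintype m] (A : Matrix l m ℝ≥0) : Monotone (maxVec A) :=
  fun _ v h i => maxVec_le_iff.2 fun j =>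
    (mul_le_mul_right (h j) (A i j)).trans (mul_le_maxVec A v i j)

theorem maxVec_smul {l m : Type*} [Fintype m] (A : Matrix l m ℝ≥0) (c : ℝ≥0) (v : m → ℝ≥0) :
    maxVec A (c • v) = c • maxVec A v := by
  ext1 i
  simp only [maxVec, Pi.smul_apply, smul_eq_mul, NNReal.mul_iSup, mul_left_comm c]

theorem maxVec_sup {l m : Type*} [Fintype m] (A : Matrix l m ℝ≥0) (u v : m → ℝ≥0) :
    maxVec A (u ⊔ v) = maxVec A u ⊔ maxVec A v := by
  refine le_antisymm (fun i => maxVec_le_iff.2 fun j => ?_)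
    (sup_le (maxVec_mono A le_sup_left) (maxVec_mono A le_sup_right))
  rw [Pi.sup_apply, Pi.sup_apply, mul_max]
  exact sup_le_sup (mul_le_maxVec A u i j) (mul_le_maxVec A v i j)

theorem maxVec_maxMul {l m p : Type*} [Fintype m] [Fintype p] (A : Matrix l m ℝ≥0)
    (B : Matrix m p ℝ≥0) (v : p → ℝ≥0) : maxVec (maxMul A B) v = maxVec A (maxVec B v) := by
  ext1 i
  simp only [maxVec, maxMul, NNReal.iSup_mul, NNReal.mul_iSup, mul_assoc]
  refine eq_of_forall_ge_iff fun c => ?_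
  simp only [ciSup_le_iff' (Set.finite_range _).bddAbove]
  exact forall_comm

theorem continuous_maxVec {l m : Type*} [Fintype m] (A : Matrix l m ℝ≥0) :
    Continuous (maxVec A) := by
  refine continuous_pi fun i => ?_
  have h : (fun v => maxVec A v i) = fun v => Finset.univ.sup fun j => A i j * v j := by
    ext1 v
    exact eq_of_forall_ge_iff fun c => by simp [maxVec_le_iff]
  rw [h]
  exact Continuous.finset_sup_apply fun j _ => by fun_prop

/-- An eigenvector of an irreducible matrix is everywhere positive. -/
theorem MaxIrreducible.eigenvector_pos {n : Type*} [Fintype n] {A : Matrix n n ℝ≥0}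
    (hA : MaxIrreducible A) {α : ℝ≥0} {v : n → ℝ≥0} (hv : v ≠ 0) (h : maxVec A v = α • v)
    (i : n) : 0 < v i := by
  obtain ⟨k, hk⟩ := Function.ne_iff.1 hv
  have step : ∀ a b, 0 < A a b → 0 < v b → 0 < v a := fun a b hab hb => by
    have := (mul_pos hab hb).trans_le (mul_le_maxVec A v a b)
    rw [h] at this
    exact pos_of_mul_pos_right this zero_le
  by_cases hik : i = k
  · exact hik ▸ pos_iff_ne_zero.2 hk
  · have hpath := hA i k hik
    clear hik
    induction hpath using Relation.TransGen.head_induction_on with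
    | single hab => exact step _ _ hab (pos_iff_ne_zero.2 hk)
    | head hab _ ih => exact step _ _ hab ih

theorem MaxIrreducible.eigenvalue_pos {n : Type*} [Fintype n] [Nontrivial n]
    {A : Matrix n n ℝ≥0} (hA : MaxIrreducible A) {α : ℝ≥0} {v : n → ℝ≥0} (hv : v ≠ 0)
    (h : maxVec A v = α • v) : 0 < α := by
  obtain ⟨i, j, hij⟩ := exists_pair_ne n
  obtain ⟨k, hk, -⟩ := Relation.TransGen.head'_iff.1 (hA i j hij)
  have := (mul_pos hk (hA.eigenvector_pos hv h k)).trans_le (mul_le_maxVec A v i k)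
  rw [h] at this
  exact pos_of_mul_pos_left this zero_le

theorem exists_pos_smul_le {n : Type*} [Finite n] [Nonempty n] {u w : n → ℝ≥0}
    (hu : ∀ i, 0 < u i) (hw : ∀ i, 0 < w i) : ∃ c : ℝ≥0, 0 < c ∧ c • u ≤ w := by
  obtain ⟨i, hi⟩ := Finite.exists_min fun i => w i / u i
  exact ⟨w i / u i, div_pos (hw i) (hu i), fun j => (le_div_iff₀ (hu j)).1 (hi j)⟩

/-- A monotone continuous self-map of a nonempty compact sup-closed set of vectors has a
fixed point. -/
theorem exists_fixedPoint_of_isCompact_supClosed {n : Type*} [Fintype n] {K : Set (n → ℝ≥0)}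
    (hK : IsCompact K) (hne : K.Nonempty) (hsup : SupClosed K) {g : (n → ℝ≥0) → n → ℝ≥0}
    (hg : Continuous g) (hmono : Monotone g) (hmaps : Set.MapsTo g K K) :
    ∃ x ∈ K, g x = x := by
  have eq_of_sum_le : ∀ {a b : n → ℝ≥0}, a ≤ b → ∑ i, b i ≤ ∑ i, a i → a = b :=
    fun {a b} hab hs => funext fun i =>
      (Finset.sum_eq_sum_iff_of_le fun i _ => hab i).1
        (le_antisymm (Finset.sum_le_sum fun i _ => hab i) hs) i (Finset.mem_univ i)
  have hcont : Continuous fun v : n → ℝ≥0 => ∑ i, v i := by fun_prop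
  obtain ⟨z, hz, hmax⟩ := hK.exists_isMaxOn hne hcont.continuousOn
  have hgz : g z ≤ z :=
    sup_eq_left.1 (eq_of_sum_le le_sup_left (hmax (hsup hz (hmaps hz)))).symm
  obtain ⟨x, ⟨hx, hgx⟩, hmin⟩ := (hK.inter_right (isClosed_le hg continuous_id)).exists_isMinOn
    ⟨z, hz, hgz⟩ hcont.continuousOn
  exact ⟨x, hx, eq_of_sum_le hgx (hmin ⟨hmaps hx, hmono hgx⟩)⟩

/-- Commuting matrices with positive eigenvectors have a common positive eigenvector for any
given pair of eigenvalues `α` of `A` and `β ≠ 0` of `B`. -/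
theorem exists_common_eigenvector {n : Type*} [Fintype n] [Nonempty n] {A B : Matrix n n ℝ≥0}
    (hcomm : maxMul A B = maxMul B A) {α β : ℝ≥0} (hβ : β ≠ 0) {u w : n → ℝ≥0}
    (hu : ∀ i, 0 < u i) (hAu : maxVec A u = α • u) (hw : ∀ i, 0 < w i)
    (hBw : maxVec B w = β • w) :
    ∃ v : n → ℝ≥0, (∀ i, 0 < v i) ∧ maxVec A v = α • v ∧ maxVec B v = β • v := by
  obtain ⟨c, hc, hcu⟩ := exists_pos_smul_le hu hw
  obtain ⟨d, hd, hdw⟩ := exists_pos_smul_le hw fun i => (mul_pos hc (hu i) : 0 < (c • u) i)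
  let g : (n → ℝ≥0) → n → ℝ≥0 := fun v => β⁻¹ • maxVec B v
  have hg : Continuous g := (continuous_const_smul β⁻¹).comp (continuous_maxVec B)
  have hmono : Monotone g := fun a b hab i => mul_le_mul_right (maxVec_mono B hab i) _
  have hgw : g w = w := by simp only [g, hBw, inv_smul_smul₀ hβ]
  have hgdw : g (d • w) = d • w := by
    simp only [g, maxVec_smul, hBw, smul_comm d, inv_smul_smul₀ hβ]
  obtain ⟨x, ⟨hx, hAx⟩, hgx⟩ := exists_fixedPoint_of_isCompact_supClosed
    (K := Set.Icc (d • w) w ∩ {v | maxVec A v = α • v})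
    (isCompact_Icc.inter_right (isClosed_eq (continuous_maxVec A) (continuous_const_smul α)))
    ⟨c • u, ⟨hdw, hcu⟩, by
      simp only [Set.mem_ofPred_eq, maxVec_smul, hAu, smul_comm c]⟩
    (fun a ha b hb => ⟨⟨le_sup_of_le_left ha.1.1, sup_le ha.1.2 hb.1.2⟩, by
      have h₁ : maxVec A a = α • a := ha.2
      have h₂ : maxVec A b = α • b := hb.2
      ext1 i
      simp [maxVec_sup, h₁, h₂, mul_max]⟩)
    hg hmono
    (fun a ha => ⟨⟨hgdw ▸ hmono ha.1.1, (hmono ha.1.2).trans_eq hgw⟩, by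
      have h₁ : maxVec A a = α • a := ha.2
      simp only [Set.mem_ofPred_eq, g, maxVec_smul, ← maxVec_maxMul A B, hcomm]
      rw [maxVec_maxMul, h₁, maxVec_smul, smul_comm]⟩)
  refine ⟨x, fun i => (mul_pos hd (hw i)).trans_le (hx.1 i), hAx, ?_⟩
  conv_rhs => rw [← hgx]
  exact (smul_inv_smul₀ hβ _).symm

/-- The edges `(i, j)` at which the eigenvalue equation of `A` for `v` is attained. -/
def SaturationRel {n : Type*} (A : Matrix n n ℝ≥0) (α : ℝ≥0) (v : n → ℝ≥0) (i j : n) : Prop :=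
  A i j * v j = α * v i

theorem exists_saturationRel {n : Type*} [Fintype n] [Nonempty n] {A : Matrix n n ℝ≥0}
    {α : ℝ≥0} {v : n → ℝ≥0} (h : maxVec A v = α • v) (i : n) :
    ∃ j, SaturationRel A α v i j := by
  obtain ⟨j, hj⟩ := exists_mul_eq_maxVec A v i
  exact ⟨j, hj.trans (congrFun h i)⟩

theorem exists_saturationRel_comp {n : Type*} [Fintype n] [Nonempty n] {A B : Matrix n n ℝ≥0}
    (hcomm : maxMul A B = maxMul B A) {α β : ℝ≥0} (hα : 0 < α) (hβ : 0 < β) {v : n → ℝ≥0}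
    (hv : ∀ i, 0 < v i) (hAv : maxVec A v = α • v) (hBv : maxVec B v = β • v) {i j k : n}
    (hij : SaturationRel A α v i j) (hjk : SaturationRel B β v j k) :
    ∃ m, SaturationRel B β v i m ∧ SaturationRel A α v m k := by
  have hA : ∀ a b, A a b * v b ≤ α * v a := fun a b =>
    (mul_le_maxVec A v a b).trans_eq (congrFun hAv a)
  have hB : ∀ a b, B a b * v b ≤ β * v a := fun a b =>
    (mul_le_maxVec B v a b).trans_eq (congrFun hBv a)
  obtain ⟨m, hm⟩ : ∃ m, B i m * A m k = maxMul B A i k := exists_eq_ciSup_of_finite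
  have hle : A i j * B j k ≤ B i m * A m k := by
    rw [hm, ← hcomm]
    exact le_ciSup (f := fun j => A i j * B j k) (Set.finite_range _).bddAbove j
  have key : α * (β * v i) ≤ B i m * (A m k * v k) := calc
    α * (β * v i) = A i j * (B j k * v k) := by
      rw [show B j k * v k = β * v j from hjk, mul_left_comm (A i j),
        show A i j * v j = α * v i from hij, mul_left_comm]
    _ = A i j * B j k * v k := (mul_assoc _ _ _).symm
    _ ≤ B i m * A m k * v k := mul_le_mul_left hle _
    _ = B i m * (A m k * v k) := mul_assoc _ _ _
  have h₁ : B i m * (A m k * v k) ≤ α * (B i m * v m) :=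
    (mul_le_mul_right (hA m k) _).trans_eq (mul_left_comm _ _ _)
  have hBm : SaturationRel B β v i m :=
    (hB i m).antisymm (le_of_mul_le_mul_left (key.trans h₁) hα)
  have hpos : 0 < B i m :=
    pos_of_mul_pos_left (hBm.symm ▸ mul_pos hβ (hv i) : 0 < B i m * v m) zero_le
  refine ⟨m, hBm, (hA m k).antisymm (le_of_mul_le_mul_left ?_ hpos)⟩
  rwa [mul_left_comm, show B i m * v m = β * v i from hBm]

theorem exists_cycleWeight_eq {n : Type*} {A : Matrix n n ℝ≥0} {α : ℝ≥0} {v : n → ℝ≥0} {i : n}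
    (hv : 0 < v i) (h : Relation.TransGen (SaturationRel A α v) i i) :
    ∃ l : List n, l ≠ [] ∧ l.head? = some i ∧ cycleWeight A l = α ^ l.length := by
  have path : ∀ a, Relation.TransGen (SaturationRel A α v) a i → ∃ t : List n,
      (((a :: t).zip (t ++ [i])).map fun p => A p.1 p.2).prod * v i =
        α ^ (t.length + 1) * v a := by
    intro a ha
    induction ha using Relation.TransGen.head_induction_on with
    | single hab => exact ⟨[], by simpa [SaturationRel] using hab⟩
    | @head a b hab _ ih =>
      obtain ⟨t, ht⟩ := ih
      refine ⟨b :: t, ?_⟩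
      rw [List.cons_append, List.zip_cons_cons, List.map_cons, List.prod_cons, mul_assoc, ht,
        mul_left_comm, show A a b * v b = α * v a from hab, List.length_cons, pow_succ _ (_ + 1),
        mul_assoc]
  obtain ⟨t, ht⟩ := path i h
  refine ⟨i :: t, by simp, rfl, ?_⟩
  rw [cycleWeight, List.rotate_cons_succ, List.rotate_zero]
  exact mul_right_cancel₀ hv.ne' ht

theorem exists_mem_rel_self_of_finite {n : Type*} [Finite n] (r : n → n → Prop) [IsTrans n r]
    {T : Set n} (hT : T.Nonempty) (h : ∀ j ∈ T, ∃ d ∈ T, r d j) : ∃ j ∈ T, r j j := by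
  by_contra! hirr
  let s : T → T → Prop := fun a b => r a b
  have : IsTrans T s := ⟨fun _ _ _ hab hbc => _root_.trans (r := r) hab hbc⟩
  have : Std.Irrefl s := ⟨fun a => hirr a a.2⟩
  have := hT.to_subtype
  obtain ⟨m, -, hm⟩ := (Finite.wellFounded_of_trans_of_irrefl s).has_min Set.univ
    Set.univ_nonempty
  obtain ⟨d, hd, hdm⟩ := h m m.2
  exact hm ⟨d, hd⟩ (Set.mem_univ _) hdm

/-- Two serial relations on a finite type such that `E` followed by `F` is contained in `F`
followed by `E` have a common node lying on a cycle of each. -/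
theorem exists_common_transGen_self {n : Type*} [Finite n] [Nonempty n] {E F : n → n → Prop}
    (hE : ∀ i, ∃ j, E i j) (hF : ∀ i, ∃ j, F i j)
    (hEF : ∀ {i j k}, E i j → F j k → ∃ m, F i m ∧ E m k) :
    ∃ i, Relation.TransGen E i i ∧ Relation.TransGen F i i := by
  have hEF' : ∀ {i j k}, Relation.TransGen E i j → F j k →
      ∃ m, F i m ∧ Relation.TransGen E m k := by
    intro i j k hij hjk
    induction hij using Relation.TransGen.head_induction_on with
    | single hab =>
      obtain ⟨m, hm, hmk⟩ := hEF hab hjk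
      exact ⟨m, hm, .single hmk⟩
    | head hab _ ih =>
      obtain ⟨m, hm, hmk⟩ := ih
      obtain ⟨p, hp, hpm⟩ := hEF hab hm
      exact ⟨p, hp, .head hpm hmk⟩
  obtain ⟨i₀, -, hi₀⟩ := exists_mem_rel_self_of_finite
    (Function.swap (Relation.TransGen E)) Set.univ_nonempty fun j _ =>
      (hE j).imp fun d hd => ⟨Set.mem_univ d, .single hd⟩
  obtain ⟨i, hi, hFi⟩ := exists_mem_rel_self_of_finite
    (Function.swap (Relation.TransGen F)) (T := {i | Relation.TransGen E i i}) ⟨i₀, hi₀⟩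
    fun i hi => by
      obtain ⟨j, hj, hjj⟩ := exists_mem_rel_self_of_finite (Relation.TransGen E)
        (T := {j | F i j}) (hF i) fun j hj => hEF' hi hj
      exact ⟨j, hjj, .single hj⟩
  exact ⟨i, hi, hFi⟩

theorem cycleWeight_singleton {n : Type*} (A : Matrix n n ℝ≥0) (i : n) :
    cycleWeight A [i] = A i i := by
  simp [cycleWeight]

theorem apply_self_eq_eigenvalue_of_subsingleton {n : Type*} [Fintype n] [Subsingleton n]
    {A : Matrix n n ℝ≥0} {α : ℝ≥0} {v : n → ℝ≥0} (hv : v ≠ 0) (h : maxVec A v = α • v) (i : n) :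
    A i i = α := by
  obtain ⟨k, hk⟩ := Function.ne_iff.1 hv
  have : Nonempty n := ⟨i⟩
  obtain ⟨j, hj⟩ := exists_saturationRel h i
  obtain rfl := Subsingleton.elim i k
  obtain rfl := Subsingleton.elim i j
  exact mul_right_cancel₀ hk hj

theorem common_eigennode_of_commuting_irreducible {n : Type*} [Fintype n] [Nonempty n]
    (A B : Matrix n n ℝ≥0)
    (hA : MaxIrreducible A) (hB : MaxIrreducible B)
    (hcomm : maxMul A B = maxMul B A)
    (α β : ℝ≥0)
    (hα : ∃ v : n → ℝ≥0, v ≠ 0 ∧ maxVec A v = α • v)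
    (hβ : ∃ w : n → ℝ≥0, w ≠ 0 ∧ maxVec B w = β • w) :
    ∃ (i : n) (l₁ l₂ : List n),
      l₁ ≠ [] ∧ l₂ ≠ [] ∧ l₁.head? = some i ∧ l₂.head? = some i ∧
      cycleWeight A l₁ = α ^ l₁.length ∧ cycleWeight B l₂ = β ^ l₂.length := by
  obtain ⟨u, hu, hAu⟩ := hα
  obtain ⟨w, hw, hBw⟩ := hβ
  rcases subsingleton_or_nontrivial n with hn | hn
  · obtain ⟨i⟩ := ‹Nonempty n›
    refine ⟨i, [i], [i], by simp, by simp, rfl, rfl, ?_, ?_⟩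
    · simpa [cycleWeight_singleton] using apply_self_eq_eigenvalue_of_subsingleton hu hAu i
    · simpa [cycleWeight_singleton] using apply_self_eq_eigenvalue_of_subsingleton hw hBw i
  · have hα := hA.eigenvalue_pos hu hAu
    have hβ := hB.eigenvalue_pos hw hBw
    obtain ⟨v, hv, hAv, hBv⟩ := exists_common_eigenvector hcomm hβ.ne'
      (hA.eigenvector_pos hu hAu) hAu (hB.eigenvector_pos hw hBw) hBw
    obtain ⟨i, hiA, hiB⟩ := exists_common_transGen_self (exists_saturationRel hAv)
      (exists_saturationRel hBv) (exists_saturationRel_comp hcomm hα hβ hv hAv hBv)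
    obtain ⟨l₁, hne₁, hh₁, hl₁⟩ := exists_cycleWeight_eq (hv i) hiA
    obtain ⟨l₂, hne₂, hh₂, hl₂⟩ := exists_cycleWeight_eq (hv i) hiB
    exact ⟨i, l₁, l₂, hne₁, hne₂, hh₁, hh₂, hl₁, hl₂⟩
end

section
/- Let A, B : Matrix n n ℝ be nonnegative matrices over a finite type n with A * B = B * A, and suppose B is irreducible. Then: (i) A has a unique distinguished eigenvalue, i.e. if A.mulVec v = α • v and A.mulVec w = β • w with v, w nonnegative and nonzero, then α = β; (ii) A is completely reducible, i.e. its access relation is symmetric: for all i, j, Relation.ReflTransGen (fun i j => 0 < A i j) i j implies Relation.ReflTransGen (fun i j => 0 < A i j) j i. -/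
/-- A nonnegative real matrix is irreducible if its positivity digraph is
strongly connected. -/
def NonnegIrreducible {n : Type*} (B : Matrix n n ℝ) : Prop :=
  ∀ i j : n, i ≠ j → Relation.TransGen (fun a b => 0 < B a b) i j

open Matrix in
theorem mulVec_pos_of_entries_pos {n : Type*} [Fintype n] {C : Matrix n n ℝ}
    (hC : ∀ i j, 0 < C i j) {x : n → ℝ} (hx : ∀ i, 0 ≤ x i) (hx0 : x ≠ 0) (i : n) :
    0 < (C *ᵥ x) i := by
  obtain ⟨j, hj⟩ := Function.ne_iff.mp hx0
  exact Finset.sum_pos' (fun k _ => mul_nonneg (hC i k).le (hx k))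
    ⟨j, Finset.mem_univ j, mul_pos (hC i j) (lt_of_le_of_ne (hx j) (Ne.symm hj))⟩

open Matrix in
/-- Perron's theorem: a matrix with positive entries has a positive eigenvector. -/
theorem exists_pos_eigenvector_of_entries_pos {n : Type*} [Fintype n] [Nonempty n]
    {C : Matrix n n ℝ} (hC : ∀ i j, 0 < C i j) :
    ∃ (r : ℝ) (u : n → ℝ), (∀ i, 0 < u i) ∧ C *ᵥ u = r • u := by
  classical
  let K : Set (ℝ × (n → ℝ)) :=
    (Set.Icc 0 (∑ i, ∑ j, C i j) ×ˢ stdSimplex ℝ n) ∩ {p | ∀ i, p.1 * p.2 i ≤ (C *ᵥ p.2) i}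
  have mem_K : ∀ r x, 0 ≤ r → x ∈ stdSimplex ℝ n → (∀ i, r * x i ≤ (C *ᵥ x) i) →
      (r, x) ∈ K := by
    intro r x hr hx h
    refine ⟨⟨⟨hr, ?_⟩, hx⟩, h⟩
    calc r = ∑ i, r * x i := by rw [← Finset.mul_sum, hx.2, mul_one]
      _ ≤ ∑ i, (C *ᵥ x) i := Finset.sum_le_sum fun i _ => h i
      _ ≤ ∑ i, ∑ j, C i j := by
        refine Finset.sum_le_sum fun i _ => Finset.sum_le_sum fun j _ => ?_
        have hx1 : x j ≤ 1 :=
          hx.2 ▸ Finset.single_le_sum (fun k _ => hx.1 k) (Finset.mem_univ j)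
        exact mul_le_of_le_one_right (hC i j).le hx1
  have hK : IsCompact K := by
    refine (isCompact_Icc.prod (isCompact_stdSimplex ℝ n)).inter_right ?_
    simp only [Set.ofPred_forall]
    refine isClosed_iInter fun i => isClosed_le (by fun_prop) ?_
    simp only [mulVec, dotProduct]
    fun_prop
  have hne : K.Nonempty := by
    obtain ⟨i⟩ := (inferInstance : Nonempty n)
    have hx := single_mem_stdSimplex ℝ i
    refine ⟨(0, Pi.single i 1), mem_K 0 _ le_rfl hx fun k => ?_⟩
    rw [zero_mul]
    exact Finset.sum_nonneg fun j _ => mul_nonneg (hC k j).le (hx.1 j)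
  obtain ⟨⟨r, x⟩, ⟨⟨⟨hr, -⟩, hx⟩, hrx⟩, hmax⟩ :=
    hK.exists_isMaxOn hne (f := Prod.fst) continuous_fst.continuousOn
  simp only [Set.mem_ofPred_eq] at hr hx hrx
  have hx0 : x ≠ 0 := by
    rintro rfl
    simpa using hx.2
  have hz := mulVec_pos_of_entries_pos hC hx.1 hx0
  have heq : C *ᵥ x = r • x := by
    by_contra hne'
    have hd := mulVec_pos_of_entries_pos hC (x := C *ᵥ x - r • x)
      (fun i => sub_nonneg.mpr (hrx i)) (sub_ne_zero.mpr hne')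
    set z := C *ᵥ x with hzdef
    obtain ⟨i, hi⟩ := Finite.exists_min fun i => (C *ᵥ z) i / z i
    have hlt : r < (C *ᵥ z) i / z i := by
      rw [lt_div_iff₀ (hz i)]
      have h := hd i
      rw [mulVec_sub, mulVec_smul, ← hzdef] at h
      simpa using h
    have hs : 0 < ∑ k, z k := Finset.sum_pos (fun k _ => hz k) Finset.univ_nonempty
    have hmem := mem_K ((C *ᵥ z) i / z i) ((∑ k, z k)⁻¹ • z) (hr.trans hlt.le)
      ⟨fun k => mul_nonneg (inv_nonneg.mpr hs.le) (hz k).le, by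
        simp only [Pi.smul_apply, smul_eq_mul]
        rw [← Finset.mul_sum, inv_mul_cancel₀ hs.ne']⟩ (fun k => by
        rw [mulVec_smul, Pi.smul_apply, Pi.smul_apply, smul_eq_mul, smul_eq_mul,
          mul_left_comm]
        exact mul_le_mul_of_nonneg_left ((le_div_iff₀ (hz k)).mp (hi k))
          (inv_nonneg.mpr hs.le))
    exact absurd (hmax hmem) (not_le.mpr hlt)
  refine ⟨r, x, fun i => ?_, heq⟩
  have h := hz i
  rw [heq, Pi.smul_apply, smul_eq_mul] at h
  exact pos_of_mul_pos_right h hr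

open Matrix in
/-- The Perron eigenvalue of a matrix with positive entries is geometrically simple. -/
theorem eigenvector_eq_smul_of_entries_pos {n : Type*} [Fintype n] [Nonempty n]
    {C : Matrix n n ℝ} (hC : ∀ i j, 0 < C i j) {r : ℝ} {u x : n → ℝ} (hu : ∀ i, 0 < u i)
    (hCu : C *ᵥ u = r • u) (hCx : C *ᵥ x = r • x) : ∃ t : ℝ, x = t • u := by
  obtain ⟨i, hi⟩ := Finite.exists_min fun i => x i / u i
  refine ⟨x i / u i, ?_⟩
  by_contra hne
  have h := mulVec_pos_of_entries_pos hC (x := x - (x i / u i) • u)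
    (fun k => sub_nonneg.mpr ((le_div_iff₀ (hu k)).mp (hi k))) (sub_ne_zero.mpr hne) i
  rw [mulVec_sub, mulVec_smul, hCu, hCx, smul_comm, ← smul_sub] at h
  simp [div_mul_cancel₀ _ (hu i).ne'] at h

open Matrix in
theorem exists_pos_eigenvector_of_commute_entries_pos {n : Type*} [Fintype n] [Nonempty n]
    {A C : Matrix n n ℝ} (hC : ∀ i j, 0 < C i j) (hAC : A * C = C * A) :
    ∃ (α : ℝ) (u : n → ℝ), (∀ i, 0 < u i) ∧ A *ᵥ u = α • u := by
  obtain ⟨r, u, hu, hCu⟩ := exists_pos_eigenvector_of_entries_pos hC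
  obtain ⟨α, hα⟩ := eigenvector_eq_smul_of_entries_pos hC (x := A *ᵥ u) hu hCu (by
    rw [mulVec_mulVec, ← hAC, ← mulVec_mulVec, hCu, mulVec_smul])
  exact ⟨α, u, hu, hα⟩

/-- Some power of `1 + B` has positive entries when `B` is nonnegative and irreducible. -/
theorem NonnegIrreducible.exists_one_add_pow_pos {n : Type*} [Fintype n] [DecidableEq n]
    {B : Matrix n n ℝ} (hB : ∀ i j, 0 ≤ B i j) (hirr : NonnegIrreducible B) :
    ∃ N : ℕ, ∀ i j, 0 < ((1 + B) ^ N) i j := by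
  have hnn : ∀ (N : ℕ) (i j : n), 0 ≤ ((1 + B) ^ N) i j := by
    intro N
    induction N with
    | zero => intro i j; rw [pow_zero, Matrix.one_apply]; split_ifs <;> norm_num
    | succ N ih =>
      intro i j
      rw [pow_succ, mul_add, mul_one, Matrix.add_apply]
      exact add_nonneg (ih i j) (Finset.sum_nonneg fun k _ => mul_nonneg (ih i k) (hB k j))
  have hstep : ∀ (N : ℕ) (i j : n),
      ((1 + B) ^ (N + 1)) i j = ((1 + B) ^ N) i j + ∑ k, ((1 + B) ^ N) i k * B k j := by
    intro N i j
    rw [pow_succ, mul_add, mul_one, Matrix.add_apply, Matrix.mul_apply]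
  have hreach : ∀ i j, Relation.ReflTransGen (fun a b => 0 < B a b) i j →
      ∃ N : ℕ, 0 < ((1 + B) ^ N) i j := by
    intro i j h
    induction h with
    | refl => exact ⟨0, by simp⟩
    | @tail b c _ hbc ih =>
      obtain ⟨N, hN⟩ := ih
      refine ⟨N + 1, ?_⟩
      rw [hstep]
      exact add_pos_of_nonneg_of_pos (hnn N i c)
        (Finset.sum_pos' (fun k _ => mul_nonneg (hnn N i k) (hB k c))
          ⟨b, Finset.mem_univ b, mul_pos hN hbc⟩)
  have hev : ∀ i j, ∀ᶠ N : ℕ in Filter.atTop, 0 < ((1 + B) ^ N) i j := by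
    intro i j
    obtain ⟨N, hN⟩ := hreach i j (by
      by_cases hij : i = j
      · rw [hij]
      · exact (hirr i j hij).to_reflTransGen)
    filter_upwards [Filter.eventually_ge_atTop N] with M hM
    induction M, hM using Nat.le_induction with
    | base => exact hN
    | succ M _ ih =>
      rw [hstep]
      exact add_pos_of_pos_of_nonneg ih
        (Finset.sum_nonneg fun k _ => mul_nonneg (hnn M i k) (hB k j))
  exact (Filter.eventually_all.mpr fun i => Filter.eventually_all.mpr (hev i)).exists

open Matrix in
/-- A nonnegative matrix with positive left and right eigenvectors for the same eigenvalue
has no entry leading into a set of indices that no entry leads out of. -/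
theorem mem_of_pos_entry_of_closed {n : Type*} [Fintype n] {A : Matrix n n ℝ}
    (hA : ∀ i j, 0 ≤ A i j) {α : ℝ} {u y : n → ℝ} (hu : ∀ i, 0 < u i) (hy : ∀ i, 0 < y i)
    (hAu : A *ᵥ u = α • u) (hyA : Aᵀ *ᵥ y = α • y) {S : Set n}
    (hS : ∀ k l, k ∈ S → 0 < A k l → l ∈ S) {k l : n} (hl : l ∈ S) (hkl : 0 < A k l) :
    k ∈ S := by
  classical
  by_contra hk
  let c : n → n → ℝ := fun a b => y a * A a b * u b
  have hc : ∀ a b, 0 ≤ c a b := fun a b => mul_nonneg (mul_nonneg (hy a).le (hA a b)) (hu b).le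
  have hrow : ∀ a, ∑ b, c a b = α * (y a * u a) := by
    intro a
    have h := congrFun hAu a
    simp only [mulVec, dotProduct, Pi.smul_apply, smul_eq_mul] at h
    simp only [c, mul_assoc, ← Finset.mul_sum]
    rw [h]
    ring
  have hcol : ∀ b, ∑ a, c a b = α * (y b * u b) := by
    intro b
    have h := congrFun hyA b
    simp only [mulVec, dotProduct, Pi.smul_apply, smul_eq_mul, transpose_apply] at h
    simp only [c, ← Finset.sum_mul, mul_comm (y _)]
    rw [h]
    ring
  let T : Finset n := Finset.univ.filter (· ∈ S)
  have hT : ∀ a, a ∈ T ↔ a ∈ S := by simp [T]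
  have hout : ∑ a ∈ T, ∑ b, c a b = ∑ a ∈ T, ∑ b ∈ T, c a b := by
    refine Finset.sum_congr rfl fun a ha =>
      (Finset.sum_subset (Finset.subset_univ T) fun b _ hb => ?_).symm
    have h0 : A a b = 0 := le_antisymm
      (not_lt.mp fun h => hb ((hT b).mpr (hS a b ((hT a).mp ha) h))) (hA a b)
    simp [c, h0]
  have hin : ∑ b ∈ T, ∑ a ∈ T, c a b < ∑ b ∈ T, ∑ a, c a b := by
    refine Finset.sum_lt_sum
      (fun b _ => Finset.sum_le_univ_sum_of_nonneg fun a => hc a b)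
      ⟨l, (hT l).mpr hl, Finset.sum_lt_sum_of_subset (Finset.subset_univ T) (Finset.mem_univ k)
        (fun h => hk ((hT k).mp h)) (mul_pos (mul_pos (hy k) hkl) (hu l)) fun a _ _ => hc a l⟩
  rw [Finset.sum_comm, ← hout] at hin
  simp only [hrow, hcol] at hin
  exact lt_irrefl _ hin

theorem commuting_with_irreducible_nonneg {n : Type*} [Fintype n]
    (A B : Matrix n n ℝ)
    (hA : ∀ i j, 0 ≤ A i j) (hB : ∀ i j, 0 ≤ B i j)
    (hcomm : A * B = B * A) (hirr : NonnegIrreducible B) :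
    -- (i) `A` has a unique distinguished eigenvalue
    (∀ (α β : ℝ) (v w : n → ℝ),
      v ≠ 0 → (∀ i, 0 ≤ v i) → A.mulVec v = α • v →
      w ≠ 0 → (∀ i, 0 ≤ w i) → A.mulVec w = β • w → α = β) ∧
    -- (ii) `A` is completely reducible: its access relation is symmetric
    (∀ i j : n, Relation.ReflTransGen (fun a b => 0 < A a b) i j →
      Relation.ReflTransGen (fun a b => 0 < A a b) j i) := by
  classical
  rcases isEmpty_or_nonempty n with hn | hn
  · exact ⟨fun α β v w hv => absurd (Subsingleton.elim v 0) hv, fun i => hn.elim i⟩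
  obtain ⟨N, hN⟩ := hirr.exists_one_add_pow_pos hB
  have hAC : A * (1 + B) ^ N = (1 + B) ^ N * A :=
    (((Commute.one_right A).add_right (hcomm : Commute A B)).pow_right N).eq
  obtain ⟨α, u, hu, hAu⟩ := exists_pos_eigenvector_of_commute_entries_pos hN hAC
  obtain ⟨γ, y, hy, hyA⟩ := exists_pos_eigenvector_of_commute_entries_pos
    (A := A.transpose) (C := ((1 + B) ^ N).transpose) (fun i j => hN j i)
    (by rw [← Matrix.transpose_mul, ← Matrix.transpose_mul, hAC])
  have huniq : ∀ (β : ℝ) (v : n → ℝ), v ≠ 0 → (∀ i, 0 ≤ v i) → A.mulVec v = β • v →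
      β = γ := by
    intro β v hv0 hv hAv
    obtain ⟨j, hj⟩ := Function.ne_iff.mp hv0
    have hpos : 0 < dotProduct y v :=
      Finset.sum_pos' (fun k _ => mul_nonneg (hy k).le (hv k))
        ⟨j, Finset.mem_univ j, mul_pos (hy j) (lt_of_le_of_ne (hv j) (Ne.symm hj))⟩
    have h := Matrix.dotProduct_mulVec y A v
    rw [← Matrix.mulVec_transpose, hyA, hAv, dotProduct_smul, smul_dotProduct,
      smul_eq_mul, smul_eq_mul] at h
    exact mul_right_cancel₀ hpos.ne' h
  refine ⟨fun α β v w hv0 hv hAv hw0 hw hAw =>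
    (huniq α v hv0 hv hAv).trans (huniq β w hw0 hw hAw).symm, fun i j hij => ?_⟩
  have hαγ : α = γ := huniq α u
    (fun h => (hu (Classical.arbitrary n)).ne' (congrFun h _)) (fun i => (hu i).le) hAu
  subst hαγ
  induction hij using Relation.ReflTransGen.head_induction_on with
  | refl => exact .refl
  | head hik _ ih =>
    exact mem_of_pos_entry_of_closed hA hu hy hAu hyA
      (S := {k | Relation.ReflTransGen (fun a b => 0 < A a b) j k})
      (fun _ _ hk hkl => hk.tail hkl) ih hik
end
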